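/- arXiv:1401.4477 — 3 statements merged into one kernel-verified Lean document; each statement's English description precedes it below -/
import Mathlib

section
/- Let f₀ : ℝ³ × ℝ³ → ℝ be smooth and compactly supported. Then for every t ∈ ℝ and x ∈ ℝ³, the vector field G(t,x) := ∫₀^t ∫_{ℝ³} v f₀(x − s v, v) dv ds satisfies the divergence identity ∇_x · G(t,x) = ∫_{ℝ³} f₀(x,v) dv − ∫_{ℝ³} f₀(x − t v, v) dv. -/
open MeasureTheory

lemma key_diff {P A E : Type*} [NormedAddCommGroup P] [NormedSpace ℝ P] [ProperSpace P]
    [NormedAddCommGroup A] [SecondCountableTopology A] [MeasurableSpace A] [BorelSpace A]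
    (μ : Measure A) [IsFiniteMeasureOnCompacts μ]
    [NormedAddCommGroup E] [NormedSpace ℝ E] {K : Set A} (hK : IsCompact K)
    (F : P → A → E) (F' : P → A → P →L[ℝ] E)
    (hF : Continuous (Function.uncurry F)) (hF' : Continuous (Function.uncurry F'))
    (h : ∀ x a, HasFDerivAt (fun y => F y a) (F' x a) x) (x : P) :
    HasFDerivAt (fun y => ∫ a in K, F y a ∂μ) (∫ a in K, F' x a ∂μ) x := by
  have hc : IsCompact (Metric.closedBall x 1 ×ˢ K) := (isCompact_closedBall x 1).prod hK
  obtain ⟨C, hC⟩ := hc.exists_bound_of_continuousOn hF'.continuousOn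
  have hFx : ∀ y, Continuous (F y) := fun y => hF.comp (by fun_prop : Continuous fun a => (y, a))
  have hFx' : ∀ y, Continuous (F' y) :=
    fun y => hF'.comp (by fun_prop : Continuous fun a => (y, a))
  refine hasFDerivAt_integral_of_dominated_of_fderiv_le (bound := fun _ => C)
    (F' := F') (Metric.closedBall_mem_nhds x one_pos) (.of_forall fun y => ?_) ?_ ?_ ?_ ?_ ?_
  · exact (hFx y).continuousOn.aestronglyMeasurable_of_isCompact hK hK.measurableSet
  · exact (hFx x).continuousOn.integrableOn_compact hK
  · exact (hFx' x).continuousOn.aestronglyMeasurable_of_isCompact hK hK.measurableSet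
  · filter_upwards [ae_restrict_mem hK.measurableSet] with a ha y hy
    exact hC (y, a) ⟨hy, ha⟩
  · exact continuousOn_const.integrableOn_compact hK
  · exact .of_forall fun a y _ => h y a

lemma key_cont {P A E : Type*} [NormedAddCommGroup P] [NormedSpace ℝ P] [ProperSpace P]
    [NormedAddCommGroup A] [SecondCountableTopology A] [MeasurableSpace A] [BorelSpace A]
    (μ : Measure A) [IsLocallyFiniteMeasure μ]
    [NormedAddCommGroup E] [NormedSpace ℝ E] {K : Set A} (hK : IsCompact K)
    (F : P → A → E) 
    (hF : Continuous (Function.uncurry F)) :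
    Continuous (fun y => ∫ a in K, F y a ∂μ) :=
  continuous_parametric_integral_of_continuous hF hK

set_option maxHeartbeats 800000 in
theorem divergence_of_time_integrated_current (f₀ : (Fin 3 → ℝ) × (Fin 3 → ℝ) → ℝ)
    (hf₀ : ContDiff ℝ (⊤ : ℕ∞) f₀) (hsupp : HasCompactSupport f₀)
    (G : ℝ → (Fin 3 → ℝ) → (Fin 3 → ℝ))
    (hG : ∀ t x, G t x = ∫ s in (0:ℝ)..t, ∫ v : Fin 3 → ℝ, f₀ (x - s • v, v) • v) :
    ∀ (t : ℝ) (x : Fin 3 → ℝ),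
      (∑ i : Fin 3, fderiv ℝ (fun y => G t y i) x (Pi.single i 1)) =
        (∫ v : Fin 3 → ℝ, f₀ (x, v)) - ∫ v : Fin 3 → ℝ, f₀ (x - t • v, v) := by
  intro t x
  obtain ⟨K, hK, hKz⟩ : ∃ K : Set (Fin 3 → ℝ), IsCompact K ∧ ∀ y v, v ∉ K → f₀ (y, v) = 0 := by
    refine ⟨Prod.snd '' tsupport f₀, hsupp.isCompact.image continuous_snd, fun y v hv => ?_⟩
    by_contra h
    exact hv ⟨(y, v), subset_tsupport _ h, rfl⟩
  have hc : Continuous f₀ := hf₀.continuous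
  have hd : Differentiable ℝ f₀ := hf₀.differentiable (by simp)
  have hdc : Continuous (fderiv ℝ f₀) := hf₀.continuous_fderiv (by simp)
  have e1 : ∀ (y : Fin 3 → ℝ) (s : ℝ), ∫ v : Fin 3 → ℝ, f₀ (y - s • v, v) • v
      = ∫ v in K, f₀ (y - s • v, v) • v := fun y s =>
    (setIntegral_eq_integral_of_forall_compl_eq_zero fun v hv => by simp [hKz _ v hv]).symm
  have e2 : ∀ s : ℝ, ∫ v : Fin 3 → ℝ, f₀ (x - s • v, v)
      = ∫ v in K, f₀ (x - s • v, v) := fun s =>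
    (setIntegral_eq_integral_of_forall_compl_eq_zero fun v hv => by simp [hKz _ v hv]).symm
  -- the x-derivative
  let D : (Fin 3 → ℝ) → ℝ → (Fin 3 → ℝ) → (Fin 3 → ℝ) →L[ℝ] (Fin 3 → ℝ) := fun y s v =>
    ((fderiv ℝ f₀ (y - s • v, v)).comp (ContinuousLinearMap.inl ℝ _ _)).smulRight v
  have hDc : Continuous fun p : ((Fin 3 → ℝ) × ℝ) × (Fin 3 → ℝ) => D p.1.1 p.1.2 p.2 := by
    have h1 : Continuous fun p : ((Fin 3 → ℝ) × ℝ) × (Fin 3 → ℝ) =>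
        (fderiv ℝ f₀ (p.1.1 - p.1.2 • p.2, p.2)) := hdc.comp (by fun_prop)
    have h2 := (h1.clm_comp (continuous_const (y := ContinuousLinearMap.inl ℝ (Fin 3 → ℝ) (Fin 3 → ℝ))))
    exact ((ContinuousLinearMap.smulRightL ℝ (Fin 3 → ℝ) (Fin 3 → ℝ)).continuous.comp h2).clm_apply
      continuous_snd
  have hFc : Continuous fun p : ((Fin 3 → ℝ) × ℝ) × (Fin 3 → ℝ) =>
      f₀ (p.1.1 - p.1.2 • p.2, p.2) • p.2 := (hc.comp (by fun_prop)).smul continuous_snd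
  have hD : ∀ (y : Fin 3 → ℝ) (s : ℝ) (v : Fin 3 → ℝ), HasFDerivAt (fun y => f₀ (y - s • v, v) • v) (D y s v) y := by
    intro y s v
    have h1 : HasFDerivAt (fun y : Fin 3 → ℝ => (y - s • v, v))
        (ContinuousLinearMap.inl ℝ (Fin 3 → ℝ) (Fin 3 → ℝ)) y :=
      ((hasFDerivAt_id y).sub_const _).prodMk (hasFDerivAt_const v y)
    exact (((hd _).hasFDerivAt).comp y h1).smul_const v
  have hin : ∀ (y : Fin 3 → ℝ) (s : ℝ), HasFDerivAt (fun y => ∫ v in K, f₀ (y - s • v, v) • v)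
      (∫ v in K, D y s v) y := fun y s =>
    key_diff volume hK (fun y v => f₀ (y - s • v, v) • v) (fun y v => D y s v)
      (hFc.comp (by fun_prop : Continuous fun p : (Fin 3 → ℝ) × (Fin 3 → ℝ) => ((p.1, s), p.2)))
      (hDc.comp (by fun_prop : Continuous fun p : (Fin 3 → ℝ) × (Fin 3 → ℝ) => ((p.1, s), p.2)))
      (fun y v => hD y s v) y
  have hinc : Continuous fun p : (Fin 3 → ℝ) × ℝ => ∫ v in K, f₀ (p.1 - p.2 • v, v) • v :=
    key_cont volume hK (fun (p : (Fin 3 → ℝ) × ℝ) v => f₀ (p.1 - p.2 • v, v) • v) hFc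
  have hinDc : Continuous fun p : (Fin 3 → ℝ) × ℝ => ∫ v in K, D p.1 p.2 v :=
    key_cont volume hK (fun (p : (Fin 3 → ℝ) × ℝ) v => D p.1 p.2 v) hDc
  have hout : ∀ a b : ℝ, HasFDerivAt (fun y => ∫ s in Set.Ioc a b, ∫ v in K, f₀ (y - s • v, v) • v)
      (∫ s in Set.Ioc a b, ∫ v in K, D x s v) x := by
    intro a b
    simp only [← integral_Icc_eq_integral_Ioc]
    exact key_diff volume isCompact_Icc (fun y s => ∫ v in K, f₀ (y - s • v, v) • v)
      (fun y s => ∫ v in K, D y s v) hinc hinDc hin x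
  have hGd : HasFDerivAt (G t) (∫ s in (0:ℝ)..t, ∫ v in K, D x s v) x := by
    have : G t = fun y => ∫ s in (0:ℝ)..t, ∫ v in K, f₀ (y - s • v, v) • v := by
      funext y; rw [hG]; simp only [e1]
    rw [this]
    exact (hout 0 t).sub (hout t 0)
  let T : ((Fin 3 → ℝ) →L[ℝ] (Fin 3 → ℝ)) →L[ℝ] ℝ :=
    ∑ i : Fin 3, (ContinuousLinearMap.proj (R := ℝ) (φ := fun _ : Fin 3 => ℝ) i).comp
      (ContinuousLinearMap.apply ℝ (Fin 3 → ℝ) (Pi.single i (1:ℝ) : Fin 3 → ℝ))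
  have hT : ∀ L, T L = ∑ i : Fin 3, L (Pi.single i 1) i := fun L => by
    simp [T]
  have hTD : ∀ s v, T (D x s v) = fderiv ℝ f₀ (x - s • v, v) (v, 0) := by
    intro s v
    rw [hT]
    have hv : (v, (0 : Fin 3 → ℝ)) = ContinuousLinearMap.inl ℝ (Fin 3 → ℝ) (Fin 3 → ℝ)
        (∑ i, v i • (Pi.single i 1 : Fin 3 → ℝ)) := by
      rw [← pi_eq_sum_univ' v]; rfl
    rw [hv, map_sum, map_sum]
    refine Finset.sum_congr rfl fun i _ => ?_
    simp only [map_smul, D, ContinuousLinearMap.smulRight_apply, Pi.smul_apply, smul_eq_mul,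
      ContinuousLinearMap.comp_apply]
    ring
  have hL : (∑ i : Fin 3, fderiv ℝ (fun y => G t y i) x (Pi.single i 1))
      = T (∫ s in (0:ℝ)..t, ∫ v in K, D x s v) := by
    rw [hT]
    refine Finset.sum_congr rfl fun i _ => ?_
    rw [((hasFDerivAt_pi'.1 hGd) i).fderiv]
    rfl
  have hDs : Continuous fun s => ∫ v in K, D x s v :=
    hinDc.comp (by fun_prop : Continuous fun s : ℝ => (x, s))
  have hDv : ∀ s, Continuous fun v => D x s v := fun s =>
    hDc.comp (by fun_prop : Continuous fun v : Fin 3 → ℝ => ((x, s), v))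
  rw [hL, ← T.intervalIntegral_comp_comm (hDs.intervalIntegrable _ _)]
  have hTs : ∀ s, T (∫ v in K, D x s v) = ∫ v in K, fderiv ℝ f₀ (x - s • v, v) (v, 0) := by
    intro s
    rw [← T.integral_comp_comm ((hDv s).continuousOn.integrableOn_compact hK)]
    simp only [hTD]
  -- time derivative
  let B : ℝ → (Fin 3 → ℝ) → ℝ →L[ℝ] ℝ := fun s v =>
    ContinuousLinearMap.toSpanSingleton ℝ (-T (D x s v))
  have hTc : Continuous fun p : ℝ × (Fin 3 → ℝ) => T (D x p.1 p.2) :=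
    T.continuous.comp (hDc.comp
      (by fun_prop : Continuous fun p : ℝ × (Fin 3 → ℝ) => ((x, p.1), p.2)))
  have hBc : Continuous (Function.uncurry B) :=
    (ContinuousLinearMap.toSpanSingletonCLE (𝕜 := ℝ) (E := ℝ)).continuous.comp hTc.neg
  have hB : ∀ s v, HasFDerivAt (fun s : ℝ => f₀ (x - s • v, v)) (B s v) s := by
    intro s v
    have h1 : HasDerivAt (fun s : ℝ => (x - s • v, v)) (-v, 0) s := by
      have := ((hasDerivAt_id s).smul_const v).const_sub x
      simpa using this.prodMk (hasDerivAt_const s v)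
    have h2 := ((hd (x - s • v, v)).hasFDerivAt).comp_hasDerivAt s h1
    have h3 : fderiv ℝ f₀ (x - s • v, v) (-v, 0) = - T (D x s v) := by
      rw [hTD, ← map_neg]; simp
    rw [h3] at h2
    exact h2.hasFDerivAt
  have hh : ∀ s, HasDerivAt (fun s => ∫ v in K, f₀ (x - s • v, v))
      (- T (∫ v in K, D x s v)) s := by
    intro s
    have h0 : Continuous (fun p : ℝ × (Fin 3 → ℝ) => f₀ (x - p.1 • p.2, p.2)) :=
      hc.comp (by fun_prop)
    have h1 := (key_diff volume hK (fun (s : ℝ) v => f₀ (x - s • v, v)) B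
      h0 hBc hB s).hasDerivAt
    have hBs : Continuous (B s) :=
      Continuous.uncurry_left s hBc
    have h4 : IntegrableOn (B s) K volume := hBs.continuousOn.integrableOn_compact hK
    have h5 : IntegrableOn (fun v => D x s v) K volume :=
      (hDv s).continuousOn.integrableOn_compact hK
    have h6 := ContinuousLinearMap.integral_apply h4 (1 : ℝ)
    have h7 := T.integral_comp_comm h5
    have h8 : (∫ v in K, B s v) (1 : ℝ) = - T (∫ v in K, D x s v) := by
      rw [h6, ← h7, ← integral_neg]
      refine integral_congr_ae (.of_forall fun v => ?_)
      simp [B]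
    rw [h8] at h1
    exact h1
  have hftc := intervalIntegral.integral_eq_sub_of_hasDerivAt (a := 0) (b := t)
    (fun s _ => hh s) ((T.continuous.comp hDs).neg.intervalIntegrable _ _)
  rw [intervalIntegral.integral_neg] at hftc
  have e0 := e2 0
  simp only [zero_smul, sub_zero] at e0 hftc
  rw [e0, e2 t]
  linarith
end

section
/- Let f₀ : ℝ³ × ℝ³ → ℝ be smooth and compactly supported, and let E₀ : ℝ³ → ℝ³ be continuously differentiable with ∇_x · E₀(x) = ∫_{ℝ³} f₀(x,v) dv − 1 for all x ∈ ℝ³. Define E(t,x) := E₀(x) − ∫₀^t ∫_{ℝ³} v f₀(x − s v, v) dv ds and f(t,x,v) := f₀(x − t v, v). Then for every t ∈ ℝ and x ∈ ℝ³, Poisson's equation remains satisfied: ∇_x · E(t,x) = ∫_{ℝ³} f(t,x,v) dv − 1. -/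
open MeasureTheory

theorem aux_param {X Y F : Type*} [NormedAddCommGroup X] [NormedSpace ℝ X]
    [LocallyCompactSpace X]
    [TopologicalSpace Y] [SecondCountableTopology Y] [T2Space Y]
    [MeasurableSpace Y] [OpensMeasurableSpace Y]
    [NormedAddCommGroup F] [NormedSpace ℝ F] (μ : Measure Y)
    [IsFiniteMeasureOnCompacts μ]
    (φ : X → Y → F) (φ' : X → Y → X →L[ℝ] F)
    (hφ : Continuous (Function.uncurry φ)) (hφ' : Continuous (Function.uncurry φ'))
    (hd : ∀ x y, HasFDerivAt (fun x => φ x y) (φ' x y) x) {K : Set Y} (hK : IsCompact K)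
    {S : Set Y} (hSK : S ⊆ K) (hS : MeasurableSet S) (x : X) :
    HasFDerivAt (fun x => ∫ y in S, φ x y ∂μ) (∫ y in S, φ' x y ∂μ) x := by
  obtain ⟨U, hU, hUx⟩ := exists_compact_mem_nhds x
  obtain ⟨M, hM⟩ := (hU.prod hK).bddAbove_image hφ'.norm.continuousOn
  have hfin : μ S < ⊤ := (measure_mono hSK).trans_lt hK.measure_lt_top
  have hc : ∀ x, Continuous (φ x) := fun x => hφ.comp (by fun_prop : Continuous fun y => (x, y))
  have hc' : Continuous (φ' x) := hφ'.comp (by fun_prop : Continuous fun y => (x, y))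
  refine hasFDerivAt_integral_of_dominated_of_fderiv_le (bound := fun _ => M) hUx
    (Filter.Eventually.of_forall fun x => (hc x).aestronglyMeasurable)
    (((hc x).continuousOn.integrableOn_compact hK).mono_set hSK)
    hc'.aestronglyMeasurable ?_ ?_ ?_
  · refine (ae_restrict_iff' hS).2 (Filter.Eventually.of_forall fun y hy z hz => ?_)
    exact hM ⟨(z, y), ⟨hz, hSK hy⟩, rfl⟩
  · exact integrableOn_const hfin.ne
  · exact Filter.Eventually.of_forall fun y z _ => hd z y


theorem kinetic_substep_propagates_poisson (f₀ : (Fin 3 → ℝ) × (Fin 3 → ℝ) → ℝ)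
    (hf₀ : ContDiff ℝ (⊤ : ℕ∞) f₀) (hsupp : HasCompactSupport f₀)
    (E₀ : (Fin 3 → ℝ) → (Fin 3 → ℝ)) (hE₀ : ContDiff ℝ 1 E₀)
    (hPoisson₀ : ∀ x : Fin 3 → ℝ,
      (∑ i : Fin 3, fderiv ℝ (fun y => E₀ y i) x (Pi.single i 1)) =
        (∫ v : Fin 3 → ℝ, f₀ (x, v)) - 1)
    (E : ℝ → (Fin 3 → ℝ) → (Fin 3 → ℝ))
    (hE : ∀ t x, E t x = E₀ x - ∫ s in (0:ℝ)..t, ∫ v : Fin 3 → ℝ, f₀ (x - s • v, v) • v)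
    (f : ℝ → (Fin 3 → ℝ) → (Fin 3 → ℝ) → ℝ)
    (hf : ∀ t x v, f t x v = f₀ (x - t • v, v)) :
    ∀ (t : ℝ) (x : Fin 3 → ℝ),
      (∑ i : Fin 3, fderiv ℝ (fun y => E t y i) x (Pi.single i 1)) =
        (∫ v : Fin 3 → ℝ, f t x v) - 1 := by
  have hf1 : Differentiable ℝ f₀ := hf₀.differentiable (by simp)
  have hDc : Continuous (fderiv ℝ f₀) := hf₀.continuous_fderiv (by simp)
  have hfc : Continuous f₀ := hf₀.continuous
  set D := fderiv ℝ f₀ with hD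
  obtain ⟨K, hK, hK0⟩ : ∃ K : Set (Fin 3 → ℝ), IsCompact K ∧ ∀ x v, v ∉ K → f₀ (x, v) = 0 := by
    refine ⟨Prod.snd '' tsupport f₀, hsupp.isCompact.image continuous_snd, fun x v hv => ?_⟩
    by_contra h
    exact hv ⟨(x, v), subset_tsupport _ h, rfl⟩
  have hKm := hK.measurableSet
  have e1 : ∀ (s : ℝ) (y : Fin 3 → ℝ), ∫ v, f₀ (y - s • v, v) • v =
      ∫ v in K, f₀ (y - s • v, v) • v := fun s y =>
    (setIntegral_eq_integral_of_forall_compl_eq_zero fun v hv => by simp [hK0 _ v hv]).symm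
  have e2 : ∀ (s : ℝ) (y : Fin 3 → ℝ), ∫ v, f₀ (y - s • v, v) =
      ∫ v in K, f₀ (y - s • v, v) := fun s y =>
    (setIntegral_eq_integral_of_forall_compl_eq_zero fun v hv => hK0 _ v hv).symm
  intro t x
  -- derivative in y of the current
  let A : ℝ → (Fin 3 → ℝ) → (Fin 3 → ℝ) → ((Fin 3 → ℝ) →L[ℝ] (Fin 3 → ℝ)) := fun s y v =>
    ((D (y - s • v, v)).comp (ContinuousLinearMap.inl ℝ _ _)).smulRight v
  have hAc : Continuous fun p : ℝ × (Fin 3 → ℝ) × (Fin 3 → ℝ) => A p.1 p.2.1 p.2.2 := by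
    have h1 : Continuous fun p : ℝ × (Fin 3 → ℝ) × (Fin 3 → ℝ) =>
      (D (p.2.1 - p.1 • p.2.2, p.2.2)).comp
        (ContinuousLinearMap.inl ℝ (Fin 3 → ℝ) (Fin 3 → ℝ)) :=
      (hDc.comp (by fun_prop)).clm_comp continuous_const
    have h2 : Continuous fun p : ℝ × (Fin 3 → ℝ) × (Fin 3 → ℝ) => p.2.2 := by fun_prop
    exact ((ContinuousLinearMap.smulRightL ℝ (Fin 3 → ℝ) (Fin 3 → ℝ)).continuous.comp h1).clm_apply h2
  have hAd : ∀ s y v, HasFDerivAt (fun y => f₀ (y - s • v, v) • v) (A s y v) y := by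
    intro s y v
    have h1 : HasFDerivAt (fun y : Fin 3 → ℝ => (y - s • v, v))
        (ContinuousLinearMap.inl ℝ (Fin 3 → ℝ) (Fin 3 → ℝ)) y :=
      ((hasFDerivAt_id y).sub_const _).prodMk (hasFDerivAt_const v y)
    exact ((hf1 _).hasFDerivAt.comp y h1).smul_const v
  let J : ℝ → (Fin 3 → ℝ) → (Fin 3 → ℝ) := fun s y => ∫ v in K, f₀ (y - s • v, v) • v
  let J' : ℝ → (Fin 3 → ℝ) → ((Fin 3 → ℝ) →L[ℝ] (Fin 3 → ℝ)) := fun s y => ∫ v in K, A s y v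
  have hJd : ∀ s y, HasFDerivAt (J s) (J' s y) y := by
    intro s y
    refine aux_param volume (fun y v => f₀ (y - s • v, v) • v) (A s) ?_ ?_ (hAd s) hK
      subset_rfl hKm y
    · exact (hfc.comp (by fun_prop : Continuous fun p : (Fin 3 → ℝ) × (Fin 3 → ℝ) =>
        (p.1 - s • p.2, p.2))).smul continuous_snd
    · exact hAc.comp (by fun_prop : Continuous fun p : (Fin 3 → ℝ) × (Fin 3 → ℝ) => (s, p))
  have hJc : Continuous fun p : (Fin 3 → ℝ) × ℝ => J p.2 p.1 := by
    refine continuous_parametric_integral_of_continuous (μ := volume)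
      (f := fun (p : (Fin 3 → ℝ) × ℝ) v => f₀ (p.1 - p.2 • v, v) • v) ?_ hK
    exact (hfc.comp (by fun_prop : Continuous fun p : ((Fin 3 → ℝ) × ℝ) × (Fin 3 → ℝ) =>
        (p.1.1 - p.1.2 • p.2, p.2))).smul continuous_snd
  have hJ'c : Continuous fun p : (Fin 3 → ℝ) × ℝ => J' p.2 p.1 := by
    refine continuous_parametric_integral_of_continuous (μ := volume)
      (f := fun (p : (Fin 3 → ℝ) × ℝ) v => A p.2 p.1 v) ?_ hK
    exact hAc.comp (by fun_prop : Continuous fun p : ((Fin 3 → ℝ) × ℝ) × (Fin 3 → ℝ) =>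
        (p.1.2, p.1.1, p.2))
  have hG : HasFDerivAt (fun y => ∫ s in (0:ℝ)..t, J s y) (∫ s in (0:ℝ)..t, J' s x) x := by
    simp only [intervalIntegral.intervalIntegral_eq_integral_uIoc]
    have h := aux_param volume (fun y s => J s y) (fun y s => J' s y) hJc hJ'c
      (fun y s => hJd s y) (isCompact_uIcc (a := 0) (b := t)) Set.uIoc_subset_uIcc
      measurableSet_uIoc x
    exact h.const_smul (if (0:ℝ) ≤ t then (1:ℝ) else -1)
  have hE' : HasFDerivAt (E t) (fderiv ℝ E₀ x - ∫ s in (0:ℝ)..t, J' s x) x := by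
    have : E t = fun y => E₀ y - ∫ s in (0:ℝ)..t, J s y := by
      funext y
      simp only [hE, e1, J]
    rw [this]
    exact ((hE₀.differentiable (by simp)) x).hasFDerivAt.sub hG
  -- the trace
  let L : ((Fin 3 → ℝ) →L[ℝ] (Fin 3 → ℝ)) →L[ℝ] ℝ := ∑ i : Fin 3,
    (ContinuousLinearMap.proj (R := ℝ) (φ := fun _ : Fin 3 => ℝ) i).comp
      (ContinuousLinearMap.apply ℝ (Fin 3 → ℝ) (Pi.single i (1:ℝ)))
  have hL : ∀ B, L B = ∑ i : Fin 3, B (Pi.single i 1) i := by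
    intro B; simp [L]
  have hdiv : ∀ (g : (Fin 3 → ℝ) → (Fin 3 → ℝ)) (B) (_ : HasFDerivAt g B x),
      (∑ i : Fin 3, fderiv ℝ (fun y => g y i) x (Pi.single i 1)) = L B := by
    intro g B h
    rw [hL]
    refine Finset.sum_congr rfl fun i _ => ?_
    rw [(hasFDerivAt_pi'.1 h i).fderiv]
    rfl
  have hLA : ∀ s v, L (A s x v) = D (x - s • v, v) (v, 0) := by
    intro s v
    have hv : (v, (0 : Fin 3 → ℝ)) = ContinuousLinearMap.inl ℝ (Fin 3 → ℝ) (Fin 3 → ℝ)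
        (∑ i : Fin 3, v i • Pi.single i (1:ℝ)) := by
      have : (∑ i : Fin 3, v i • Pi.single i (1:ℝ)) = v := by
        ext j; simp [Finset.sum_apply, Pi.single_apply]
      rw [this]; rfl
    rw [hL, hv, map_sum, map_sum]
    refine Finset.sum_congr rfl fun i _ => ?_
    rw [map_smul, map_smul]
    simp [A, mul_comm]
  have hDvc : Continuous fun p : ℝ × (Fin 3 → ℝ) => D (x - p.1 • p.2, p.2) (p.2, 0) :=
    (hDc.comp (by fun_prop)).clm_apply (by fun_prop)
  have hLJ : ∀ s, L (J' s x) = ∫ v in K, D (x - s • v, v) (v, 0) := by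
    intro s
    have hc : Continuous (A s x) := hAc.comp (by fun_prop : Continuous fun v => (s, x, v))
    rw [← L.integral_comp_comm (hc.continuousOn.integrableOn_compact hK)]
    simp only [hLA]
  -- time derivative of the density
  have hrho : ∀ s, HasDerivAt (fun s : ℝ => ∫ v in K, f₀ (x - s • v, v)) (-L (J' s x)) s := by
    intro s
    have h := aux_param volume (fun (s : ℝ) v => f₀ (x - s • v, v))
      (fun s v => ContinuousLinearMap.toSpanSingleton ℝ (- D (x - s • v, v) (v, 0)))
      (hfc.comp (by fun_prop)) ?_ ?_ hK subset_rfl hKm s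
    · have h' := h.hasDerivAt
      refine h'.congr_deriv (Eq.symm ?_)
      rw [hLJ, ← integral_neg, ContinuousLinearMap.integral_apply]
      · simp
      · refine (Continuous.continuousOn ?_).integrableOn_compact hK
        exact (ContinuousLinearMap.toSpanSingletonCLE (𝕜 := ℝ) (E := ℝ)).continuous.comp
          (hDvc.comp (by fun_prop : Continuous fun v => (s, v))).neg
    · exact (ContinuousLinearMap.toSpanSingletonCLE (𝕜 := ℝ) (E := ℝ)).continuous.comp hDvc.neg
    · intro s v
      have h1 : HasDerivAt (fun s : ℝ => (x - s • v, v)) (-v, (0 : Fin 3 → ℝ)) s := by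
        have := (((hasDerivAt_id s).smul_const v).const_sub x).prodMk (hasDerivAt_const s v)
        simpa using this
      have h2 := (hf1 (x - s • v, v)).hasFDerivAt.comp_hasDerivAt s h1
      have h3 : (-v, (0 : Fin 3 → ℝ)) = -(v, 0) := by simp
      rw [h3, map_neg] at h2
      exact h2.hasFDerivAt
  have hJx : Continuous fun s => J' s x := hJ'c.comp (by fun_prop : Continuous fun s : ℝ => (x, s))
  have hftc := intervalIntegral.integral_eq_sub_of_hasDerivAt (a := 0) (b := t)
    (fun s _ => hrho s) ((L.continuous.comp hJx).neg.intervalIntegrable _ _)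
  rw [intervalIntegral.integral_neg, L.intervalIntegral_comp_comm (hJx.intervalIntegrable _ _)]
    at hftc
  have h0 := hPoisson₀ x
  rw [hdiv E₀ _ ((hE₀.differentiable (by simp)) x).hasFDerivAt] at h0
  have e3 := e2 0 x
  rw [hdiv _ _ hE', map_sub, h0]
  simp only [hf, e2]
  simp only [zero_smul, sub_zero] at e3 hftc
  linarith
end

section
/- Let k ∈ ℝ with k ≠ 0, Δt ∈ ℝ, and let g : ℝ² → ℂ be integrable. Define ψ : ℝ → ℂ by ψ(v₁) = (exp(−i k v₁ Δt) − 1)/(i k v₁) for v₁ ≠ 0 and ψ(0) = −Δt, set ρ̂ⁿ := ∫_{ℝ²} g(v) dv and ρ̂ⁿ⁺¹ := ∫_{ℝ²} g(v) exp(−i k v₁ Δt) dv, and suppose Êⁿ ∈ ℂ satisfies the discrete Poisson equation i k Êⁿ = ρ̂ⁿ. Then the updated field Êⁿ⁺¹ := Êⁿ + ∫_{ℝ²} v₁ g(v) ψ(v₁) dv satisfies i k Êⁿ⁺¹ = ρ̂ⁿ⁺¹. -/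
open MeasureTheory Complex

theorem hamiltonian_splitting_discrete_charge_conservation
    (k Δt : ℝ) (hk : k ≠ 0) (g : (Fin 2 → ℝ) → ℂ)
    (hg : Integrable g (volume : Measure (Fin 2 → ℝ)))
    (ψ : ℝ → ℂ)
    (hψ : ∀ v₁ : ℝ, v₁ ≠ 0 →
      ψ v₁ = (Complex.exp (-(Complex.I * k * v₁ * Δt)) - 1) / (Complex.I * k * v₁))
    (hψ₀ : ψ 0 = -(Δt : ℂ))
    (ρn ρn1 : ℂ)
    (hρn : ρn = ∫ v : Fin 2 → ℝ, g v)
    (hρn1 : ρn1 = ∫ v : Fin 2 → ℝ, g v * Complex.exp (-(Complex.I * k * (v 0) * Δt)))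
    (En : ℂ) (hPoisson : Complex.I * k * En = ρn)
    (En1 : ℂ) (hEn1 : En1 = En + ∫ v : Fin 2 → ℝ, (v 0 : ℂ) * g v * ψ (v 0)) :
    Complex.I * k * En1 = ρn1 := by
  have hint : Integrable (fun v : Fin 2 → ℝ =>
      g v * Complex.exp (-(Complex.I * k * (v 0) * Δt))) volume := by
    refine hg.mul_bdd (c := 1) ?_ ?_
    · exact Continuous.aestronglyMeasurable (by fun_prop)
    · refine Filter.Eventually.of_forall fun v => ?_
      have h : -(Complex.I * k * (v 0) * Δt) = ((-(k * v 0 * Δt) : ℝ) : ℂ) * Complex.I := by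
        push_cast; ring
      rw [h, Complex.norm_exp_ofReal_mul_I]
  have hkc : (k : ℂ) ≠ 0 := by exact_mod_cast hk
  have key : ∀ v : Fin 2 → ℝ, Complex.I * k * ((v 0 : ℂ) * g v * ψ (v 0)) =
      g v * Complex.exp (-(Complex.I * k * (v 0) * Δt)) - g v := by
    intro v
    by_cases h0 : v 0 = 0
    · simp [h0]
    · have hv : (v 0 : ℂ) ≠ 0 := by exact_mod_cast h0
      have hI := Complex.I_ne_zero
      rw [hψ _ h0]
      generalize Complex.exp (-(Complex.I * k * (v 0) * Δt)) = e
      field_simp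
  rw [hEn1, mul_add, hPoisson, ← integral_const_mul, integral_congr_ae (Filter.Eventually.of_forall key),
    integral_sub hint hg, hρn, hρn1]
  ring
end
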